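/- arXiv:1112.5956 — 2 statements merged into one kernel-verified Lean document; each statement's English description precedes it below -/
import Mathlib

section
/- With the substitutions q^α = ã, q^β = b̃, q^{a-b} = q^{-N-1}, q^{a+b} = c̃/ã, the coefficient β_n of the three-term recurrence of the non-standard q-Racah polynomials satisfies lim_{N→∞} q^{N+1} ã (q^{a+1}/c₁) (β_n - c₃) = q c̃ + ã q^{n+1} (1 - ã b̃ q^{n+1})(1 - b̃ q^{n+1})(1 - c̃ q^{n+1}) / ((1 - ã b̃ q^{2n+1})(1 - ã b̃ q^{2n+2})) - q c̃ (1 - ã q^n)(1 - ã b̃ c̃^{-1} q^n)(1 - q^n) / ((1 - ã b̃ q^{2n})(1 - ã b̃ q^{2n+1})), which is the recurrence coefficient β̃_n of the monic big q-Jacobi polynomials. -/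
open Filter

/-- The symmetric `q`-number `[z]_q` for complex argument. -/
noncomputable def qnumC (q : ℝ) (z : ℂ) : ℂ :=
  ((q : ℂ) ^ (z / 2) - (q : ℂ) ^ (-z / 2)) /
    ((q : ℂ) ^ ((1 : ℂ) / 2) - (q : ℂ) ^ (-(1 : ℂ) / 2))

noncomputable def kqC (q : ℝ) : ℂ := (q : ℂ) ^ ((1 : ℂ) / 2) - (q : ℂ) ^ (-(1 : ℂ) / 2)

noncomputable def c1C (q : ℝ) : ℂ := (q : ℂ) ^ ((1 : ℂ) / 2) / (kqC q) ^ 2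

noncomputable def c3C (q : ℝ) : ℂ := -(q : ℂ) ^ (-(1 : ℂ) / 2) * (1 + (q : ℂ)) / (kqC q) ^ 2

/-- The coefficient `β_n` of the three-term recurrence of the non-standard `q`-Racah
polynomials, with parameters `a`, `b`, `α`, `β`. -/
noncomputable def qRacahBeta (q : ℝ) (a b α β : ℂ) (n : ℕ) : ℂ :=
  qnumC q a * qnumC q (a + 1) -
    qnumC q (α + β + n + 1) * qnumC q (a - b + n + 1) * qnumC q (β + n + 1) *
      qnumC q (a + b + α + n + 1) /
      (qnumC q (α + β + 2 * n + 1) * qnumC q (α + β + 2 * n + 2)) -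
    qnumC q (α + n) * qnumC q (b - a + α + β + n) * qnumC q (-a - b + β + n) * qnumC q (n : ℂ) /
      (qnumC q (α + β + 2 * n) * qnumC q (α + β + 2 * n + 1))

lemma qnumC_form (q : ℝ) (z w : ℂ) (hw : (q : ℂ) ^ (z / 2) = w) :
    qnumC q z = (w - w⁻¹) / kqC q := by
  unfold qnumC kqC
  rw [neg_div 2 z, Complex.cpow_neg, hw]

lemma inv_form (w k : ℂ) (hw : w ≠ 0) :
    ((w - w⁻¹) / k)⁻¹ = -(w * k * (1 - w ^ 2)⁻¹) := by
  have : (w - w⁻¹) / k = -((1 - w ^ 2) * w⁻¹ * k⁻¹) := by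
    field_simp
    ring
  rw [this, inv_neg, mul_inv, mul_inv, inv_inv, inv_inv]
  ring

lemma alg_key (Q u v r x s k ta tb tc : ℂ) (hQ : Q ≠ 0) (hu : u ≠ 0) (hv : v ≠ 0)
    (hr : r ≠ 0) (hx : x ≠ 0) (hs : s ≠ 0) (hk : k ≠ 0) (hta : u ^ 2 = ta) (htb : v ^ 2 = tb)
    (htc : tc = x ^ 4 * s ^ 2 * u ^ 2) :
    s ^ 2 * ta * (x ^ 2 * Q ^ 2) / (Q / k ^ 2) *
      (((x - x⁻¹) / k * ((x * Q - (x * Q)⁻¹) / k) -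
        ((u * v * r * Q - (u * v * r * Q)⁻¹) / k) * ((s⁻¹ * r * Q - (s⁻¹ * r * Q)⁻¹) / k) *
          ((v * r * Q - (v * r * Q)⁻¹) / k) *
          ((x ^ 2 * s * u * r * Q - (x ^ 2 * s * u * r * Q)⁻¹) / k) /
          (((u * v * r ^ 2 * Q - (u * v * r ^ 2 * Q)⁻¹) / k) *
            ((u * v * r ^ 2 * Q ^ 2 - (u * v * r ^ 2 * Q ^ 2)⁻¹) / k)) -
        ((u * r - (u * r)⁻¹) / k) * ((s * u * v * r - (s * u * v * r)⁻¹) / k) *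
          (((x ^ 2 * s)⁻¹ * v * r - ((x ^ 2 * s)⁻¹ * v * r)⁻¹) / k) * ((r - r⁻¹) / k) /
          (((u * v * r ^ 2 - (u * v * r ^ 2)⁻¹) / k) *
            ((u * v * r ^ 2 * Q - (u * v * r ^ 2 * Q)⁻¹) / k))) -
        -Q⁻¹ * (1 + Q ^ 2) / k ^ 2) =
    Q ^ 2 * tc + s ^ 2 * ta + ta * (r ^ 2 * Q ^ 2) *
          ((1 - ta * tb * (r ^ 2 * Q ^ 2)) * (1 - tb * (r ^ 2 * Q ^ 2)) *
            (1 - tc * (r ^ 2 * Q ^ 2))) /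
          ((1 - ta * tb * (r ^ 4 * Q ^ 2)) * (1 - ta * tb * (r ^ 4 * Q ^ 4))) *
          (1 - s ^ 2 * (r ^ 2 * Q ^ 2)⁻¹) -
        Q ^ 2 * tc * ((1 - ta * r ^ 2) * (1 - ta * tb / tc * r ^ 2) * (1 - r ^ 2)) /
          ((1 - ta * tb * r ^ 4) * (1 - ta * tb * (r ^ 4 * Q ^ 2))) *
          (1 - s ^ 2 * (ta * tb * r ^ 2)) := by
  subst hta htb htc
  rw [div_eq_mul_inv _ (((u * v * r ^ 2 * Q - (u * v * r ^ 2 * Q)⁻¹) / k) * _),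
    div_eq_mul_inv _ (((u * v * r ^ 2 - (u * v * r ^ 2)⁻¹) / k) * _),
    div_eq_mul_inv _ ((1 - u ^ 2 * v ^ 2 * (r ^ 4 * Q ^ 2)) * _),
    div_eq_mul_inv _ ((1 - u ^ 2 * v ^ 2 * r ^ 4) * _)]
  simp only [mul_inv ((_ : ℂ) / k), mul_inv ((1 : ℂ) - _)]
  rw [inv_form (u * v * r ^ 2 * Q) k (by simp [hQ, hu, hv, hr]), inv_form (u * v * r ^ 2 * Q ^ 2) k (by simp [hQ, hu, hv, hr]),
    inv_form (u * v * r ^ 2) k (by simp [hQ, hu, hv, hr])]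
  rw [show (u * v * r ^ 2 * Q) ^ 2 = u ^ 2 * v ^ 2 * (r ^ 4 * Q ^ 2) by ring,
    show (u * v * r ^ 2 * Q ^ 2) ^ 2 = u ^ 2 * v ^ 2 * (r ^ 4 * Q ^ 4) by ring,
    show (u * v * r ^ 2) ^ 2 = u ^ 2 * v ^ 2 * r ^ 4 by ring]
  generalize (1 - u ^ 2 * v ^ 2 * (r ^ 4 * Q ^ 2))⁻¹ = E1
  generalize (1 - u ^ 2 * v ^ 2 * (r ^ 4 * Q ^ 4))⁻¹ = E2
  generalize (1 - u ^ 2 * v ^ 2 * r ^ 4)⁻¹ = E0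
  field_simp
  ring

theorem qracah_beta_to_bigqjacobi_beta (q ta tb tc : ℝ)
    (hq0 : 0 < q) (hq1 : q < 1)
    (hat0 : 0 < q * ta) (hat1 : q * ta < 1) (hbt0 : 0 ≤ q * tb) (hbt1 : q * tb < 1)
    (hct : tc < 0) (n : ℕ)
    (α β : ℂ) (a : ℕ → ℂ)
    (hα : (q : ℂ) ^ α = (ta : ℂ)) (hβ : (q : ℂ) ^ β = (tb : ℂ))
    (ha : ∀ N : ℕ, (q : ℂ) ^ (2 * a N + ((N : ℂ) + 1)) = (tc : ℂ) / (ta : ℂ)) :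
    Tendsto (fun N : ℕ =>
        (q : ℂ) ^ (N + 1) * (ta : ℂ) * (q : ℂ) ^ (a N + 1) / c1C q *
          (qRacahBeta q (a N) (a N + ((N : ℂ) + 1)) α β n - c3C q)) atTop
      (nhds ((q * tc + ta * q ^ (n + 1) *
          ((1 - ta * tb * q ^ (n + 1)) * (1 - tb * q ^ (n + 1)) * (1 - tc * q ^ (n + 1))) /
          ((1 - ta * tb * q ^ (2 * n + 1)) * (1 - ta * tb * q ^ (2 * n + 2))) -
        q * tc * ((1 - ta * q ^ n) * (1 - ta * tb / tc * q ^ n) * (1 - q ^ n)) /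
          ((1 - ta * tb * q ^ (2 * n)) * (1 - ta * tb * q ^ (2 * n + 1))) : ℝ) : ℂ)) := by
  have hqC : (q : ℂ) ≠ 0 := by exact_mod_cast hq0.ne'
  have hta : (ta : ℂ) ≠ 0 := by rw [← hα]; simp [Complex.cpow_eq_zero_iff, hqC]
  have htc : (tc : ℂ) ≠ 0 := by exact_mod_cast hct.ne
  have hne : ∀ z : ℂ, (q : ℂ) ^ z ≠ 0 := fun z => by simp [Complex.cpow_eq_zero_iff, hqC]
  have hsq : ∀ z : ℂ, ((q : ℂ) ^ (z / 2)) ^ 2 = (q : ℂ) ^ z := fun z => by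
    rw [sq, ← Complex.cpow_add _ _ hqC]; congr 1; ring
  have hQ2 : ((q : ℂ) ^ ((1 : ℂ) / 2)) ^ 2 = q := by rw [hsq, Complex.cpow_one]
  have hr2 : ((q : ℂ) ^ ((n : ℂ) / 2)) ^ 2 = (q : ℂ) ^ n := by rw [hsq, Complex.cpow_natCast]
  have hk : kqC q ≠ 0 := by
    intro h
    unfold kqC at h
    rw [neg_div, Complex.cpow_neg] at h
    have h3 : ((q : ℂ) ^ ((1 : ℂ) / 2)) ^ 2 = 1 := by
      have := hne (1 / 2)
      rw [sub_eq_zero] at h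
      rw [sq]
      nth_rewrite 2 [h]
      exact mul_inv_cancel₀ this
    rw [hQ2] at h3
    have : q = 1 := by exact_mod_cast h3
    linarith
  have key : ∀ N : ℕ, (q : ℂ) ^ (N + 1) * (ta : ℂ) * (q : ℂ) ^ (a N + 1) / c1C q *
          (qRacahBeta q (a N) (a N + ((N : ℂ) + 1)) α β n - c3C q) =
      q * tc + (q : ℂ) ^ (N + 1) * ta + ta * q ^ (n + 1) *
          ((1 - ta * tb * q ^ (n + 1)) * (1 - tb * q ^ (n + 1)) * (1 - tc * q ^ (n + 1))) /
          ((1 - ta * tb * q ^ (2 * n + 1)) * (1 - ta * tb * q ^ (2 * n + 2))) *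
          (1 - (q : ℂ) ^ (N + 1) * ((q : ℂ) ^ (n + 1))⁻¹) -
        q * tc * ((1 - ta * q ^ n) * (1 - ta * tb / tc * q ^ n) * (1 - q ^ n)) /
          ((1 - ta * tb * q ^ (2 * n)) * (1 - ta * tb * q ^ (2 * n + 1))) *
          (1 - (q : ℂ) ^ (N + 1) * (ta * tb * q ^ n)) := by
    intro N
    obtain ⟨Q, hQ⟩ : ∃ Q, Q = (q : ℂ) ^ ((1 : ℂ) / 2) := ⟨_, rfl⟩
    obtain ⟨u, hu⟩ : ∃ Q, Q = (q : ℂ) ^ (α / 2) := ⟨_, rfl⟩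
    obtain ⟨v, hv⟩ : ∃ Q, Q = (q : ℂ) ^ (β / 2) := ⟨_, rfl⟩
    obtain ⟨r, hr⟩ : ∃ Q, Q = (q : ℂ) ^ ((n : ℂ) / 2) := ⟨_, rfl⟩
    obtain ⟨x, hx⟩ : ∃ Q, Q = (q : ℂ) ^ (a N / 2) := ⟨_, rfl⟩
    obtain ⟨s, hs⟩ : ∃ Q, Q = (q : ℂ) ^ (((N : ℂ) + 1) / 2) := ⟨_, rfl⟩
    have hs2 : s ^ 2 = (q : ℂ) ^ (N + 1) := by
      rw [hs, hsq, ← Complex.cpow_natCast]; push_cast; rfl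
    have hx2 : x ^ 2 = (q : ℂ) ^ (a N) := by rw [hx, hsq]
    rw [← hQ] at hQ2
    rw [← hr] at hr2
    have hu2 : u ^ 2 = ta := by rw [hu, hsq, hα]
    have hv2 : v ^ 2 = tb := by rw [hv, hsq, hβ]
    have htc' : (tc : ℂ) = x ^ 4 * s ^ 2 * u ^ 2 := by
      have h := ha N
      rw [two_mul, Complex.cpow_add _ _ hqC, Complex.cpow_add _ _ hqC, ← hx2, ← hsq (_ + 1), ← hs,
        eq_div_iff hta, ← hu2] at h
      rw [← h]; ring
    have main := alg_key Q u v r x s (kqC q) ta tb tc (hQ ▸ hne _) (hu ▸ hne _) (hv ▸ hne _)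
      (hr ▸ hne _) (hx ▸ hne _) (hs ▸ hne _) hk hu2 hv2 htc'
    have e1 : (q : ℂ) ^ (a N + 1) = x ^ 2 * Q ^ 2 := by
      rw [Complex.cpow_add _ _ hqC, Complex.cpow_one, hx2, hQ2]
    have e2 : c1C q = Q / kqC q ^ 2 := by rw [c1C, hQ]
    have e3 : c3C q = -Q⁻¹ * (1 + Q ^ 2) / kqC q ^ 2 := by
      rw [c3C, hQ2, hQ, neg_div (2 : ℂ) 1, Complex.cpow_neg]
    have hadd : ∀ y z : ℂ, (q : ℂ) ^ (y + z) = (q : ℂ) ^ y * (q : ℂ) ^ z :=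
      fun y z => Complex.cpow_add _ _ hqC
    have hneg : ∀ y : ℂ, (q : ℂ) ^ (-y) = ((q : ℂ) ^ y)⁻¹ := fun y => Complex.cpow_neg _ _
    unfold qRacahBeta
    rw [qnumC_form q (a N) x hx.symm,
        qnumC_form q (a N + 1) (x * Q) (by rw [hx, hQ, ← hadd]; congr 1; ring),
        qnumC_form q (α + β + n + 1) (u * v * r * Q)
          (by rw [hu, hv, hr, hQ, ← hadd, ← hadd, ← hadd]; congr 1; ring),
        qnumC_form q (a N - (a N + ((N : ℂ) + 1)) + n + 1) (s⁻¹ * r * Q)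
          (by rw [hs, hr, hQ, ← hneg, ← hadd, ← hadd]; congr 1; ring),
        qnumC_form q (β + n + 1) (v * r * Q)
          (by rw [hv, hr, hQ, ← hadd, ← hadd]; congr 1; ring),
        qnumC_form q (a N + (a N + ((N : ℂ) + 1)) + α + n + 1) (x ^ 2 * s * u * r * Q)
          (by rw [hx2, hs, hu, hr, hQ, ← hadd, ← hadd, ← hadd, ← hadd]; congr 1; ring),
        qnumC_form q (α + β + 2 * n + 1) (u * v * r ^ 2 * Q)
          (by rw [sq, hu, hv, hr, hQ, ← hadd, ← hadd, ← hadd, ← hadd]; congr 1; ring),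
        qnumC_form q (α + β + 2 * n + 2) (u * v * r ^ 2 * Q ^ 2)
          (by rw [sq, sq, hu, hv, hr, hQ, ← hadd, ← hadd, ← hadd, ← hadd, ← hadd]; congr 1; ring),
        qnumC_form q (α + n) (u * r) (by rw [hu, hr, ← hadd]; congr 1; ring),
        qnumC_form q (a N + ((N : ℂ) + 1) - a N + α + β + n) (s * u * v * r)
          (by rw [hs, hu, hv, hr, ← hadd, ← hadd, ← hadd]; congr 1; ring),
        qnumC_form q (-a N - (a N + ((N : ℂ) + 1)) + β + n) ((x ^ 2 * s)⁻¹ * v * r)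
          (by rw [hx2, hs, hv, hr, ← hadd, ← hneg, ← hadd, ← hadd]; congr 1; ring),
        qnumC_form q n r hr.symm,
        qnumC_form q (α + β + 2 * n) (u * v * r ^ 2)
          (by rw [sq, hu, hv, hr, ← hadd, ← hadd, ← hadd]; congr 1; ring)]
    rw [e1, e2, e3, ← hs2, main]
    have p1 : (q : ℂ) ^ (n + 1) = r ^ 2 * Q ^ 2 := by rw [pow_succ, hr2, hQ2]
    have p2 : (q : ℂ) ^ (2 * n) = r ^ 4 := by rw [mul_comm, pow_mul, ← hr2]; ring
    have p3 : (q : ℂ) ^ (2 * n + 1) = r ^ 4 * Q ^ 2 := by rw [pow_succ, p2, hQ2]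
    have p4 : (q : ℂ) ^ (2 * n + 2) = r ^ 4 * Q ^ 4 := by
      rw [pow_add, p2, ← hQ2]; ring
    rw [p1, p2, p3, p4, ← hr2, ← hQ2]
  simp only [key]
  have hp : Tendsto (fun N : ℕ => (q : ℂ) ^ (N + 1)) atTop (nhds 0) := by
    apply (tendsto_add_atTop_iff_nat 1).2
    apply tendsto_pow_atTop_nhds_zero_of_norm_lt_one
    rw [Complex.norm_real, Real.norm_of_nonneg hq0.le]; exact hq1
  have lim := (((hp.mul_const (ta : ℂ)).const_add ((q : ℂ) * tc)).add
    (((hp.mul_const (((q : ℂ) ^ (n + 1))⁻¹)).const_sub 1).const_mul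
      ((ta : ℂ) * q ^ (n + 1) *
          ((1 - ta * tb * q ^ (n + 1)) * (1 - tb * q ^ (n + 1)) * (1 - tc * q ^ (n + 1))) /
          ((1 - ta * tb * q ^ (2 * n + 1)) * (1 - ta * tb * q ^ (2 * n + 2)))))).sub
    (((hp.mul_const ((ta : ℂ) * tb * q ^ n)).const_sub 1).const_mul
      ((q : ℂ) * tc * ((1 - ta * q ^ n) * (1 - ta * tb / tc * q ^ n) * (1 - q ^ n)) /
          ((1 - ta * tb * q ^ (2 * n)) * (1 - ta * tb * q ^ (2 * n + 1)))))
  convert lim using 2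
  push_cast
  simp only [zero_mul, sub_zero, mul_one, add_zero]
end

section
/- With q^β = γ, q^{2a} = γδ, b = a+N+1 and C_n = (γδq)^{n/2} κ_q^{2n}, the limit as q^α → 0 of q^{a+1} c₁^{-1}(β_n - c₃) equals 1 + γδq - (1 - γq^{n+1})(1 - q^{n-N}) - γq(δ - q^{n-N-1})(1 - q^n), the recurrence coefficient β̃_n of the monic dual q-Hahn polynomials. -/
open Filter

/-- The symmetric `q`-number `[x]_q`. -/
noncomputable def qnum (q x : ℝ) : ℝ :=
  (q ^ (x / 2) - q ^ (-x / 2)) / (q ^ ((1 : ℝ) / 2) - q ^ (-(1 : ℝ) / 2))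

/-- `κ_q = q^{1/2} - q^{-1/2}`. -/
noncomputable def kq (q : ℝ) : ℝ := q ^ ((1 : ℝ) / 2) - q ^ (-(1 : ℝ) / 2)

noncomputable def c1 (q : ℝ) : ℝ := q ^ ((1 : ℝ) / 2) / (kq q) ^ 2

noncomputable def c3 (q : ℝ) : ℝ := -q ^ (-(1 : ℝ) / 2) * (1 + q) / (kq q) ^ 2

/-- The coefficient `β_n` of the three-term recurrence of the non-standard `q`-Racah
polynomials, with real parameters `a`, `b`, `α`, `β`. -/
noncomputable def qRacahBetaR (q a b α β : ℝ) (n : ℕ) : ℝ :=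
  qnum q a * qnum q (a + 1) -
    qnum q (α + β + n + 1) * qnum q (a - b + n + 1) * qnum q (β + n + 1) *
      qnum q (a + b + α + n + 1) /
      (qnum q (α + β + 2 * n + 1) * qnum q (α + β + 2 * n + 2)) -
    qnum q (α + n) * qnum q (b - a + α + β + n) * qnum q (-a - b + β + n) * qnum q n /
      (qnum q (α + β + 2 * n) * qnum q (α + β + 2 * n + 1))

theorem kq_ne (q : ℝ) (hq0 : 0 < q) (hq1 : q < 1) : kq q ≠ 0 := by
  unfold kq
  have h : q ^ ((1 : ℝ) / 2) < q ^ (-(1 : ℝ) / 2) :=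
    Real.rpow_lt_rpow_of_exponent_gt hq0 hq1 (by norm_num)
  linarith

theorem qnum_eq (q x : ℝ) (hq0 : 0 < q) :
    qnum q x = q ^ (-x / 2) * (q ^ x - 1) / kq q := by
  unfold qnum kq
  congr 1
  rw [mul_sub, ← Real.rpow_add hq0, mul_one]
  congr 2
  ring

theorem qnum_ratio (q x1 x2 x3 x4 y1 y2 e : ℝ) (hq0 : 0 < q) (hq1 : q < 1)
    (he : y1 + y2 - x1 - x2 - x3 - x4 = 2 * e) :
    qnum q x1 * qnum q x2 * qnum q x3 * qnum q x4 / (qnum q y1 * qnum q y2) =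
      q ^ e / kq q ^ 2 * ((q ^ x1 - 1) * (q ^ x2 - 1) * (q ^ x3 - 1) * (q ^ x4 - 1) /
        ((q ^ y1 - 1) * (q ^ y2 - 1))) := by
  have hk := kq_ne q hq0 hq1
  have h : q ^ e = q ^ (-x1 / 2) * q ^ (-x2 / 2) * q ^ (-x3 / 2) * q ^ (-x4 / 2) /
      (q ^ (-y1 / 2) * q ^ (-y2 / 2)) := by
    simp only [← Real.rpow_add hq0, ← Real.rpow_sub hq0]
    congr 1
    linarith
  have p1 := (Real.rpow_pos_of_pos hq0 (-y1 / 2)).ne'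
  have p2 := (Real.rpow_pos_of_pos hq0 (-y2 / 2)).ne'
  simp only [qnum_eq q _ hq0]
  rw [h]
  generalize q ^ y1 - 1 = Y1
  generalize q ^ y2 - 1 = Y2
  by_cases h1 : Y1 = 0
  · simp [h1]
  by_cases h2 : Y2 = 0
  · simp [h2]
  field_simp

theorem qracah_beta_to_dualqhahn_beta (q γ δ : ℝ) (hq0 : 0 < q) (hq1 : q < 1)
    (hγ0 : 0 < γ * q) (hγ1 : γ * q < 1) (hδ0 : 0 < δ * q) (hδ1 : δ * q < 1)
    (N n : ℕ) (hn : n ≤ N) :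
    Tendsto (fun t : ℝ =>
        q ^ (Real.logb q (γ * δ) / 2 + 1) / c1 q *
          (qRacahBetaR q (Real.logb q (γ * δ) / 2) (Real.logb q (γ * δ) / 2 + N + 1)
              (Real.logb q t) (Real.logb q γ) n - c3 q))
      (nhdsWithin 0 (Set.Ioi 0))
      (nhds (1 + γ * δ * q - (1 - γ * q ^ (n + 1)) * (1 - q ^ ((n : ℝ) - N)) -
        γ * q * (δ - q ^ ((n : ℝ) - N - 1)) * (1 - q ^ n))) := by
  have hγ : 0 < γ := pos_of_mul_pos_left hγ0 hq0.le
  have hδ : 0 < δ := pos_of_mul_pos_left hδ0 hq0.le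
  have hk := kq_ne q hq0 hq1
  have hne : q ≠ 1 := hq1.ne
  have hβ : q ^ Real.logb q γ = γ := Real.rpow_logb hq0 hne hγ
  have hγδ : q ^ Real.logb q (γ * δ) = γ * δ := Real.rpow_logb hq0 hne (by positivity)
  set a := Real.logb q (γ * δ) / 2 with ha
  have h2a : Real.logb q (γ * δ) = 2 * a := by rw [ha]; ring
  rw [h2a] at hγδ
  set β := Real.logb q γ with hβd
  -- the explicit rational form
  let F : ℝ → ℝ := fun t => 1 + γ * δ * q -
    (t * q ^ (β + n + 1) - 1) * (q ^ ((n : ℝ) - N) - 1) * (γ * q ^ (n + 1) - 1) *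
      (t * q ^ (2 * a + N + n + 2) - 1) /
      ((t * q ^ (β + 2 * n + 1) - 1) * (t * q ^ (β + 2 * n + 2) - 1)) -
    γ * δ * q * ((t * q ^ (n : ℝ) - 1) * (t * q ^ (N + 1 + β + n) - 1) *
      (q ^ ((n : ℝ) - N - 1) / δ - 1) * (q ^ n - 1) /
      ((t * q ^ (β + 2 * n) - 1) * (t * q ^ (β + 2 * n + 1) - 1)))
  have hF : Tendsto F (nhdsWithin 0 (Set.Ioi 0)) (nhds (F 0)) := by
    apply Tendsto.mono_left _ nhdsWithin_le_nhds
    have : ContinuousAt F 0 := by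
      simp only [F]
      fun_prop (disch := norm_num)
    exact this
  have hF0 : F 0 = 1 + γ * δ * q - (1 - γ * q ^ (n + 1)) * (1 - q ^ ((n : ℝ) - N)) -
        γ * q * (δ - q ^ ((n : ℝ) - N - 1)) * (1 - q ^ n) := by
    simp only [F]
    field_simp
    ring
  rw [← hF0]
  refine hF.congr' ?_
  filter_upwards [self_mem_nhdsWithin] with t ht
  have ht0 : 0 < t := ht
  have hα : q ^ Real.logb q t = t := Real.rpow_logb hq0 hne ht0
  set α := Real.logb q t with hαd
  have tp : ∀ x y : ℝ, x = α + y → q ^ x = t * q ^ y := by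
    intro x y h
    rw [h, Real.rpow_add hq0, hα]
  unfold qRacahBetaR
  rw [qnum_ratio q _ _ _ _ _ _ (-a - 1 / 2) hq0 hq1 (by ring),
    qnum_ratio q _ _ _ _ _ _ (a + 1 / 2) hq0 hq1 (by ring)]
  rw [tp (α + β + n + 1) (β + n + 1) (by ring),
    tp (a + (a + N + 1) + α + n + 1) (2 * a + N + n + 2) (by ring),
    tp (α + β + 2 * n + 1) (β + 2 * n + 1) (by ring),
    tp (α + β + 2 * n + 2) (β + 2 * n + 2) (by ring),
    tp (α + β + 2 * n) (β + 2 * n) (by ring),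
    tp (α + n) n rfl,
    tp (a + N + 1 - a + α + β + n) (N + 1 + β + n) (by ring)]
  have e1 : q ^ (a - (a + N + 1) + n + 1) = q ^ ((n : ℝ) - N) := by
    congr 1; ring
  have e2 : q ^ (β + n + 1) = γ * q ^ (n + 1) := by
    rw [add_assoc, Real.rpow_add hq0, hβ, ← Real.rpow_natCast q (n + 1)]
    push_cast; rfl
  have e3 : q ^ (-a - (a + N + 1) + β + n) = q ^ ((n : ℝ) - N - 1) / δ := by
    have : -a - (a + N + 1) + β + n = ((n : ℝ) - N - 1) + β - 2 * a := by ring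
    rw [this, Real.rpow_sub hq0, Real.rpow_add hq0, hβ, hγδ]
    field_simp
  simp only [F]
  rw [e1, e3, Real.rpow_natCast, qnum_eq q a hq0, qnum_eq q (a + 1) hq0]
  generalize hR1 : (t * q ^ (β + n + 1) - 1) * (q ^ ((n : ℝ) - N) - 1) * (q ^ (β + n + 1) - 1) *
      (t * q ^ (2 * a + N + n + 2) - 1) /
      ((t * q ^ (β + 2 * n + 1) - 1) * (t * q ^ (β + 2 * n + 2) - 1)) = R1
  rw [← e2, hR1]
  generalize (t * q ^ n - 1) * (t * q ^ (N + 1 + β + n) - 1) *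
      (q ^ ((n : ℝ) - N - 1) / δ - 1) * (q ^ n - 1) /
      ((t * q ^ (β + 2 * n) - 1) * (t * q ^ (β + 2 * n + 1) - 1)) = R2
  unfold c1 c3
  -- express everything through s = q^(1/2) and A = q^(a/2)
  have hs : 0 < q ^ ((1 : ℝ) / 2) := Real.rpow_pos_of_pos hq0 _
  have hA : 0 < q ^ (a / 2) := Real.rpow_pos_of_pos hq0 _
  have hs2 : q = (q ^ ((1 : ℝ) / 2)) ^ 2 := by
    rw [← Real.rpow_natCast, ← Real.rpow_mul hq0.le]; norm_num
  have hA2 : q ^ a = (q ^ (a / 2)) ^ 2 := by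
    rw [← Real.rpow_natCast, ← Real.rpow_mul hq0.le]; congr 1; push_cast; ring
  have hg : γ * δ = (q ^ (a / 2)) ^ 4 := by
    rw [← hγδ, ← Real.rpow_natCast, ← Real.rpow_mul hq0.le]; congr 1; push_cast; ring
  have f1 : q ^ (a + 1) = q ^ a * q := by rw [Real.rpow_add hq0, Real.rpow_one]
  have f2 : q ^ (-a - 1 / 2) = (q ^ a * q ^ ((1 : ℝ) / 2))⁻¹ := by
    rw [← Real.rpow_add hq0, ← Real.rpow_neg hq0.le]; congr 1; ring
  have f3 : q ^ (a + 1 / 2) = q ^ a * q ^ ((1 : ℝ) / 2) := by rw [Real.rpow_add hq0]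
  have f4 : q ^ (-a / 2) = (q ^ (a / 2))⁻¹ := by
    rw [← Real.rpow_neg hq0.le]; congr 1; ring
  have f5 : q ^ (-(a + 1) / 2) = (q ^ (a / 2) * q ^ ((1 : ℝ) / 2))⁻¹ := by
    rw [← Real.rpow_add hq0, ← Real.rpow_neg hq0.le]; congr 1; ring
  have f6 : q ^ (-(1 : ℝ) / 2) = (q ^ ((1 : ℝ) / 2))⁻¹ := by
    rw [← Real.rpow_neg hq0.le]; congr 1; ring
  rw [f1, f2, f3, f4, f5, f6, hg, hA2]
  generalize q ^ ((1 : ℝ) / 2) = s at *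
  generalize q ^ (a / 2) = A at *
  generalize kq q = k at *
  clear_value F
  rw [hs2]
  field_simp
  ring
end
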